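/- arXiv:1304.5286 — 8 statements merged into one kernel-verified Lean document; each statement's English description precedes it below -/
import Mathlib

section
/- Let S be a nonempty finite set, let g_p : [t₀,t_f] → ℝ be Lebesgue integrable for each p ∈ S, and let c ∈ ℝ. Then there exists a unique Q ∈ ℝ satisfying Q = Σ_{p∈S} ∫_{t₀}^{t_f} max(g_p(t) + c − Q, 0) dt, and this Q satisfies Q ≥ 0. -/
open MeasureTheory

/-- Existence, uniqueness and nonnegativity of the solution of the fixed-point
equation (C.14) arising in the explicit projection formula of Theorem 5.1. -/
theorem fixed_point_equation_exists_unique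
    (t₀ t_f : ℝ) (ht : t₀ < t_f)
    (S : Type*) [Fintype S] [Nonempty S]
    (g : S → ℝ → ℝ)
    (hg : ∀ p, IntegrableOn (g p) (Set.Icc t₀ t_f))
    (c : ℝ) :
    (∃! Q : ℝ, Q = ∑ p : S, ∫ t in Set.Icc t₀ t_f, max (g p t + c - Q) 0) ∧
      ∀ Q : ℝ, (Q = ∑ p : S, ∫ t in Set.Icc t₀ t_f, max (g p t + c - Q) 0) → 0 ≤ Q := by
  have hint : ∀ p Q, Integrable (fun t => max (g p t + c - Q) 0)
      (volume.restrict (Set.Icc t₀ t_f)) := by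
    intro p Q
    have h1 : Integrable (fun t => g p t + c - Q) (volume.restrict (Set.Icc t₀ t_f)) :=
      (Integrable.add (hg p) (integrable_const c)).sub (integrable_const Q)
    exact h1.pos_part
  set F : ℝ → ℝ := fun Q => ∑ p : S, ∫ t in Set.Icc t₀ t_f, max (g p t + c - Q) 0 with hF
  have hnn : ∀ Q, 0 ≤ F Q := fun Q =>
    Finset.sum_nonneg fun p _ => integral_nonneg fun t => le_max_right _ _
  have hanti : Antitone F := by
    intro a b hab
    refine Finset.sum_le_sum fun p _ => integral_mono (hint p b) (hint p a) fun t => ?_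
    exact max_le_max (by linarith) le_rfl
  have hcont : Continuous F := by
    refine continuous_finsetSum _ fun p _ => ?_
    refine continuous_iff_continuousAt.2 fun Q₀ => ?_
    refine continuousAt_of_dominated (bound := fun t => max (g p t + c - (Q₀ - 1)) 0) ?_ ?_
      (hint p _) ?_
    · exact Filter.Eventually.of_forall fun Q => (hint p Q).aestronglyMeasurable
    · filter_upwards [lt_mem_nhds (show Q₀ - 1 < Q₀ by linarith)] with Q hQ
      refine Filter.Eventually.of_forall fun t => ?_
      rw [Real.norm_of_nonneg (le_max_right _ _)]
      exact max_le_max (by linarith) le_rfl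
    · exact Filter.Eventually.of_forall fun t => by fun_prop
  refine ⟨?_, fun Q hQ => hQ.symm ▸ hnn Q⟩
  obtain ⟨Q, -, hQ⟩ := intermediate_value_Icc (hnn 0)
    (f := fun Q => Q - F Q) (by fun_prop)
    (show (0 : ℝ) ∈ Set.Icc (0 - F 0) (F 0 - F (F 0)) from
      ⟨by linarith [hnn 0], by linarith [hanti (hnn 0)]⟩)
  have hQ' : Q = F Q := sub_eq_zero.1 hQ
  refine ⟨Q, hQ', fun R hR => ?_⟩
  have hR' : R = F R := hR
  rcases le_total R Q with h | h
  · have := hanti h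
    linarith
  · have := hanti h
    linarith
end

section
/- Let H be a real Hilbert space and Λ ⊆ H. Let (Xₙ)_{n≥1} be a sequence in Λ and X* ∈ Λ with Xₙ → X* weakly and sup_n ‖Xₙ‖ < ∞. Let (yₙ)_{n≥1} be a sequence in H and y* ∈ H with ‖yₙ − y*‖ → 0. Suppose that for every X ∈ Λ there exists a sequence (Zₙ) in Λ with ‖Zₙ − X‖ → 0 and ⟨yₙ, Zₙ − Xₙ⟩ ≥ 0 for all n. Then ⟨y*, X − X*⟩ ≥ 0 for every X ∈ Λ. -/
open scoped RealInnerProductSpace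
open Filter

/-- Step 4 of the proof of Theorem 4.5 (inequality (B.11)): if `Xₙ ∈ Λ` converge
weakly to `X* ∈ Λ` and are norm-bounded, `yₙ → y*` strongly, and for every
`X ∈ Λ` there is a sequence `Zₙ ∈ Λ` converging strongly to `X` with
`⟪yₙ, Zₙ − Xₙ⟫ ≥ 0` for all `n`, then `⟪y*, X − X*⟫ ≥ 0` for every `X ∈ Λ`. -/
theorem weak_limit_solves_variational_inequality
    {H : Type*} [NormedAddCommGroup H] [InnerProductSpace ℝ H]
    (Λ : Set H) (X : ℕ → H) (Xstar : H)
    (hXmem : ∀ n, X n ∈ Λ) (hXstar : Xstar ∈ Λ)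
    (hweak : ∀ Y : H, Tendsto (fun n => ⟪X n, Y⟫) atTop (nhds ⟪Xstar, Y⟫))
    (hbdd : ∃ C : ℝ, ∀ n, ‖X n‖ ≤ C)
    (y : ℕ → H) (ystar : H)
    (hy : Tendsto (fun n => ‖y n - ystar‖) atTop (nhds 0))
    (happrox : ∀ Z ∈ Λ, ∃ Zseq : ℕ → H, (∀ n, Zseq n ∈ Λ) ∧
      Tendsto (fun n => ‖Zseq n - Z‖) atTop (nhds 0) ∧
      ∀ n, 0 ≤ ⟪y n, Zseq n - X n⟫) :
    ∀ Z ∈ Λ, 0 ≤ ⟪ystar, Z - Xstar⟫ := by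
  intro Z hZ
  obtain ⟨W, -, hW, hpos⟩ := happrox Z hZ
  obtain ⟨C, hC⟩ := hbdd
  have hy' : Tendsto y atTop (nhds ystar) := tendsto_iff_norm_sub_tendsto_zero.2 hy
  have hW' : Tendsto W atTop (nhds Z) := tendsto_iff_norm_sub_tendsto_zero.2 hW
  have h1 : Tendsto (fun n => ⟪y n, W n⟫) atTop (nhds ⟪ystar, Z⟫) := hy'.inner hW'
  have h2 : Tendsto (fun n => ⟪y n - ystar, X n⟫) atTop (nhds 0) := by
    refine squeeze_zero_norm (a := fun n => ‖y n - ystar‖ * C) (fun n => ?_) ?_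
    · exact (norm_inner_le_norm _ _).trans
        (mul_le_mul_of_nonneg_left (hC n) (norm_nonneg _))
    · simpa using hy.mul_const C
  have h3 := (h1.sub h2).sub (hweak ystar)
  have h4 : 0 ≤ ⟪ystar, Z⟫ - 0 - ⟪Xstar, ystar⟫ := by
    refine ge_of_tendsto' h3 (fun n => ?_)
    have h := hpos n
    rw [inner_sub_right] at h
    rw [inner_sub_left, real_inner_comm ystar (X n)]
    linarith
  rw [inner_sub_right, real_inner_comm Xstar ystar]
  linarith
end

section
/- Let h, h' ∈ H₁ and Q, Q' ∈ H₂, and write X = (h,Q), Y = (h',Q') ∈ E. Let P^sm ⊆ P be nonempty and let K^sm > 0, K^wm > 0, M > 0, K₂ > 0 be constants such that: (i) Σ_{p∈P^sm} ⟨A_p(h) − A_p(h'), h_p − h'_p⟩ ≥ K^sm Σ_{p∈P^sm} ‖h_p − h'_p‖²; (ii) Σ_{q∈P∖P^sm} ⟨A_q(h) − A_q(h'), h_q − h'_q⟩ ≥ −K^wm Σ_{q∈P∖P^sm} ‖h_q − h'_q‖²; (iii) M Σ_{p∈P^sm} ‖h_p − h'_p‖² ≥ Σ_{q∈P∖P^sm}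 ‖h_q − h'_q‖²; (iv) ⟨B(Q) − B(Q'), Q − Q'⟩ ≥ K₂‖Q − Q'‖²; (v) K^sm − K^wm M > 0. Then ⟨F(X) − F(Y), X − Y⟩_E ≥ min{(K^sm − K^wm M)/(M + 1), K₂} · ‖X − Y‖_E². -/
open scoped RealInnerProductSpace

/-- The key monotonicity estimate (D.2) in the proof of Theorem 5.4: if
`A : H₁ → H₁` (with components `A_p`) satisfies the mixed strongly–weakly
monotone (MSWM) conditions at the pair `h, h'` and `B : H₂ → H₂` is strongly
monotone at `Q, Q'`, then `F = (A, B)` satisfies the strong monotonicity bound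
`⟪F(X) − F(Y), X − Y⟫_E ≥ min{(K^sm − K^wm M)/(M+1), K₂}‖X − Y‖_E²`, where the
`E`-inner product and norm are the Hilbert-product ones. -/
theorem mswm_monotonicity_estimate
    (P : Type) [Fintype P] [Nonempty P] [DecidableEq P]
    (Hp : P → Type) [∀ p, NormedAddCommGroup (Hp p)] [∀ p, InnerProductSpace ℝ (Hp p)]
    (H₂ : Type) [NormedAddCommGroup H₂] [InnerProductSpace ℝ H₂]
    (A : PiLp 2 Hp → PiLp 2 Hp) (B : H₂ → H₂)
    (h h' : PiLp 2 Hp) (Q Q' : H₂)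
    (Psm : Finset P) (hPsm : Psm.Nonempty)
    (Ksm Kwm M K₂ : ℝ) (hKsm : 0 < Ksm) (hKwm : 0 < Kwm) (hM : 0 < M) (hK₂ : 0 < K₂)
    (hstrong : ∑ p ∈ Psm, ⟪A h p - A h' p, h p - h' p⟫ ≥
      Ksm * ∑ p ∈ Psm, ‖h p - h' p‖ ^ 2)
    (hweak : ∑ q ∈ Psmᶜ, ⟪A h q - A h' q, h q - h' q⟫ ≥
      -Kwm * ∑ q ∈ Psmᶜ, ‖h q - h' q‖ ^ 2)
    (hdom : M * ∑ p ∈ Psm, ‖h p - h' p‖ ^ 2 ≥ ∑ q ∈ Psmᶜ, ‖h q - h' q‖ ^ 2)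
    (hB : ⟪B Q - B Q', Q - Q'⟫ ≥ K₂ * ‖Q - Q'‖ ^ 2)
    (hpos : 0 < Ksm - Kwm * M) :
    ⟪A h - A h', h - h'⟫ + ⟪B Q - B Q', Q - Q'⟫ ≥
      min ((Ksm - Kwm * M) / (M + 1)) K₂ * (‖h - h'‖ ^ 2 + ‖Q - Q'‖ ^ 2) := by
  have e1 : ⟪A h - A h', h - h'⟫ = ∑ p ∈ Psm, ⟪A h p - A h' p, h p - h' p⟫ +
      ∑ q ∈ Psmᶜ, ⟪A h q - A h' q, h q - h' q⟫ := by
    rw [Finset.sum_add_sum_compl, PiLp.inner_apply]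
    rfl
  have e2 : ‖h - h'‖ ^ 2 = ∑ p ∈ Psm, ‖h p - h' p‖ ^ 2 + ∑ q ∈ Psmᶜ, ‖h q - h' q‖ ^ 2 := by
    rw [Finset.sum_add_sum_compl, PiLp.norm_sq_eq_of_L2]
    rfl
  rw [e1, e2]
  have hS : 0 ≤ ∑ p ∈ Psm, ‖h p - h' p‖ ^ 2 := Finset.sum_nonneg fun _ _ => by positivity
  have hT : 0 ≤ ∑ p ∈ Psmᶜ, ‖h p - h' p‖ ^ 2 := Finset.sum_nonneg fun _ _ => by positivity
  generalize ∑ p ∈ Psm, ‖h p - h' p‖ ^ 2 = S at *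
  generalize ∑ p ∈ Psmᶜ, ‖h p - h' p‖ ^ 2 = T at *
  have hc : (Ksm - Kwm * M) / (M + 1) * (M + 1) = Ksm - Kwm * M := by field_simp
  have hc0 : 0 < (Ksm - Kwm * M) / (M + 1) := by positivity
  have h1 := min_le_left ((Ksm - Kwm * M) / (M + 1)) K₂
  have h2 := min_le_right ((Ksm - Kwm * M) / (M + 1)) K₂
  generalize (Ksm - Kwm * M) / (M + 1) = c at *
  have a1 := mul_le_mul_of_nonneg_right h1 (add_nonneg hS hT)
  have a2 := mul_le_mul_of_nonneg_right h2 (sq_nonneg ‖Q - Q'‖)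
  have a3 : Kwm * T ≤ Kwm * (M * S) := mul_le_mul_of_nonneg_left hdom hKwm.le
  have a4 : c * T ≤ c * (M * S) := mul_le_mul_of_nonneg_left hdom hc0.le
  have a5 : c * (M + 1) * S = (Ksm - Kwm * M) * S := by rw [hc]
  linarith
end

section
/- Let (X^k)_{k≥0} be a proximal-point sequence for F on Λ with parameter a > 0, let X^d ∈ Λ be a dual solution, and suppose Λ has diameter at most D, where 0 < D < ∞. Then for every k ≥ 0 and every index i ∈ {0,…,k} minimizing j ↦ ‖X^{j+1} − X^j‖ over j ∈ {0,…,k}, the following holds for every X ∈ Λ: ⟨F(X^{i+1}), X − X^{i+1}⟩ ≥ −a D² / √(k+1). -/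
open scoped RealInnerProductSpace

/-- `X` is a proximal-point sequence for `F` on `Λ` with parameter `a`. -/
def IsProxPointSeq {E : Type*} [NormedAddCommGroup E] [InnerProductSpace ℝ E]
    (Λ : Set E) (F : E → E) (a : ℝ) (X : ℕ → E) : Prop :=
  (∀ k, X k ∈ Λ) ∧
    ∀ k, ∀ Y ∈ Λ, 0 ≤ ⟪F (X (k + 1)) + a • (X (k + 1) - X k), Y - X (k + 1)⟫

/-- Lemma 5.9 (inequality (5.39)): along a proximal-point sequence, any index
`i ∈ {0,…,k}` minimizing `j ↦ ‖X^{j+1} − X^j‖` yields an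
`aD²/√(k+1)`-approximate solution of the variational inequality. -/
theorem prox_point_approx_solution
    {E : Type*} [NormedAddCommGroup E] [InnerProductSpace ℝ E]
    (Λ : Set E) (F : E → E) (a : ℝ) (ha : 0 < a)
    (X : ℕ → E) (hX : IsProxPointSeq Λ F a X)
    (Xd : E) (hXd : Xd ∈ Λ) (hdual : ∀ Y ∈ Λ, 0 ≤ ⟪F Y, Y - Xd⟫)
    (D : ℝ) (hD : 0 < D) (hdiam : ∀ Y ∈ Λ, ∀ Z ∈ Λ, ‖Y - Z‖ ≤ D) :
    ∀ k : ℕ, ∀ i ≤ k,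
      (∀ j ≤ k, ‖X (i + 1) - X i‖ ≤ ‖X (j + 1) - X j‖) →
      ∀ Y ∈ Λ, -(a * D ^ 2) / Real.sqrt (k + 1) ≤ ⟪F (X (i + 1)), Y - X (i + 1)⟫ := by
  obtain ⟨hm, hp⟩ := hX
  have step : ∀ j, ‖X (j + 1) - Xd‖ ^ 2 + ‖X (j + 1) - X j‖ ^ 2 ≤ ‖X j - Xd‖ ^ 2 := by
    intro j
    have h1 := hp j Xd hXd
    have h2 := hdual _ (hm (j + 1))
    rw [inner_add_left, real_inner_smul_left, ← neg_sub (X (j + 1)) Xd, inner_neg_right,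
      inner_neg_right] at h1
    have h3 : ⟪X (j + 1) - X j, X (j + 1) - Xd⟫ ≤ 0 := by
      by_contra hc
      have := mul_pos ha (not_le.mp hc)
      linarith
    have h4 : X j - Xd = (X (j + 1) - Xd) - (X (j + 1) - X j) := by abel
    rw [h4, norm_sub_sq_real (X (j + 1) - Xd) (X (j + 1) - X j),
      real_inner_comm]
    linarith
  intro k i hi hmin Y hY
  set r := ‖X (i + 1) - X i‖ with hr
  have hr0 : 0 ≤ r := norm_nonneg _
  have tele : ∀ n ≤ k + 1, ‖X n - Xd‖ ^ 2 + n * r ^ 2 ≤ D ^ 2 := by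
    intro n
    induction n with
    | zero =>
      intro _
      have := pow_le_pow_left₀ (norm_nonneg _) (hdiam _ (hm 0) _ hXd) 2
      simpa using this
    | succ n ih =>
      intro hn
      have h1 := ih (by omega)
      have h2 := step n
      have h3 := pow_le_pow_left₀ hr0 (hmin n (by omega)) 2
      push_cast
      linarith
  have hk := tele (k + 1) le_rfl
  push_cast at hk
  have hs : 0 < Real.sqrt ((k : ℝ) + 1) := Real.sqrt_pos.mpr (by positivity)
  have hsq : Real.sqrt ((k : ℝ) + 1) ^ 2 = k + 1 := Real.sq_sqrt (by positivity)
  have hrs : r * Real.sqrt ((k : ℝ) + 1) ≤ D := by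
    refine (sq_le_sq₀ (by positivity) hD.le).mp ?_
    rw [mul_pow, hsq]
    nlinarith [sq_nonneg ‖X (k + 1) - Xd‖]
  have h1 := hp i Y hY
  rw [inner_add_left, real_inner_smul_left] at h1
  have h2 := real_inner_le_norm (X (i + 1) - X i) (Y - X (i + 1))
  have h3 : ‖X (i + 1) - X i‖ * ‖Y - X (i + 1)‖ ≤ r * D :=
    mul_le_mul_of_nonneg_left (hdiam _ hY _ (hm _)) hr0
  have h4 := mul_le_mul_of_nonneg_left (h2.trans h3) ha.le
  have h5 : a * (r * D) ≤ a * D ^ 2 / Real.sqrt (k + 1) := by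
    rw [le_div_iff₀ hs]
    have := mul_le_mul_of_nonneg_left hrs (mul_pos ha hD).le
    nlinarith
  rw [neg_div]
  linarith
end

section
/- Let (X^k)_{k≥0} be a proximal-point sequence for F on Λ with parameter a > 0, let X^d ∈ Λ be a dual solution, and suppose Λ has diameter at most D, where 0 < D < ∞. Let δ > 0 and set R = ⌈a²D⁴/δ²⌉ − 1, where ⌈z⌉ is the smallest integer ≥ z. Then there exists an index i ∈ {0,…,R} such that for every X ∈ Λ: ⟨F(X^{i+1}), X − X^{i+1}⟩ ≥ −δ. -/
open scoped RealInnerProductSpace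

/-- Theorem 5.11, claim (5.40): the proximal point method produces a
`δ`-approximate solution of the variational inequality within
`⌈a²D⁴/δ²⌉` iterations. -/
theorem prox_point_delta_approx
    {E : Type*} [NormedAddCommGroup E] [InnerProductSpace ℝ E]
    (Λ : Set E) (F : E → E) (a : ℝ) (ha : 0 < a)
    (X : ℕ → E) (hX : IsProxPointSeq Λ F a X)
    (Xd : E) (hXd : Xd ∈ Λ) (hdual : ∀ Y ∈ Λ, 0 ≤ ⟪F Y, Y - Xd⟫)
    (D : ℝ) (hD : 0 < D) (hdiam : ∀ Y ∈ Λ, ∀ Z ∈ Λ, ‖Y - Z‖ ≤ D)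
    (δ : ℝ) (hδ : 0 < δ) (R : ℕ) (hR : R = ⌈a ^ 2 * D ^ 4 / δ ^ 2⌉₊ - 1) :
    ∃ i ≤ R, ∀ Y ∈ Λ, -δ ≤ ⟪F (X (i + 1)), Y - X (i + 1)⟫ := by
  obtain ⟨hm, hp⟩ := hX
  by_contra! hcon
  have step : ∀ k, ‖X (k+1) - Xd‖ ^ 2 + ‖X (k+1) - X k‖ ^ 2 ≤ ‖X k - Xd‖ ^ 2 := by
    intro k
    have h1 := hp k Xd hXd
    have h2 := hdual _ (hm (k+1))
    rw [inner_add_left, real_inner_smul_left, ← neg_sub (X (k+1)) Xd, inner_neg_right,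
      inner_neg_right] at h1
    have h3 : ⟪X (k+1) - X k, X (k+1) - Xd⟫ ≤ 0 := by
      by_contra! h
      have := mul_pos ha h
      linarith
    have h4 := norm_sub_sq_real (X (k+1) - Xd) (X (k+1) - X k)
    have h5 : X (k+1) - Xd - (X (k+1) - X k) = X k - Xd := by abel
    rw [h5, real_inner_comm] at h4
    linarith
  have big : ∀ k ≤ R, δ ^ 2 / (a * D) ^ 2 < ‖X (k+1) - X k‖ ^ 2 := by
    intro k hk
    obtain ⟨Y, hY, hlt⟩ := hcon k hk
    have h1 := hp k Y hY
    rw [inner_add_left, real_inner_smul_left] at h1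
    have h2 := real_inner_le_norm (X (k+1) - X k) (Y - X (k+1))
    have h3 := hdiam Y hY _ (hm (k+1))
    have h4 := mul_le_mul_of_nonneg_left h3 (norm_nonneg (X (k+1) - X k))
    have h5 := mul_le_mul_of_nonneg_left (h2.trans h4) ha.le
    have h6 : δ / (a * D) < ‖X (k+1) - X k‖ := by
      rw [div_lt_iff₀ (by positivity)]
      linarith
    rw [← div_pow]
    exact pow_lt_pow_left₀ h6 (by positivity) (by norm_num)
  have tel : ∀ n ≤ R, ‖X (n+1) - Xd‖ ^ 2 + (n+1) * (δ ^ 2 / (a * D) ^ 2) < ‖X 0 - Xd‖ ^ 2 := by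
    intro n
    induction n with
    | zero =>
      intro h
      have := step 0
      have := big 0 h
      push_cast
      linarith
    | succ n ih =>
      intro h
      have := ih (by omega)
      have := step (n+1)
      have := big (n+1) h
      push_cast
      linarith
  have ht := tel R le_rfl
  have h0 := pow_le_pow_left₀ (norm_nonneg _) (hdiam _ (hm 0) _ hXd) 2
  have hN : a ^ 2 * D ^ 4 / δ ^ 2 ≤ (R : ℝ) + 1 := by
    refine (Nat.le_ceil _).trans ?_
    have : ⌈a ^ 2 * D ^ 4 / δ ^ 2⌉₊ ≤ R + 1 := by omega
    exact_mod_cast this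
  have h7 := mul_le_mul_of_nonneg_right hN (show 0 ≤ δ ^ 2 / (a * D) ^ 2 by positivity)
  have h8 : a ^ 2 * D ^ 4 / δ ^ 2 * (δ ^ 2 / (a * D) ^ 2) = D ^ 2 := by
    field_simp
  have := sq_nonneg ‖X (R+1) - Xd‖
  linarith
end

section
/- Let (X^k)_{k≥0} be a proximal-point sequence for F on Λ with parameter a > 0, and suppose Λ has diameter at most D, where 0 < D < ∞. Let δ > 0 and suppose for some k ≥ 0 that ‖X^{k+1} − X^k‖ ≤ δ/(aD). Then for every X ∈ Λ: ⟨F(X^{k+1}), X − X^{k+1}⟩ ≥ −δ. -/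
open scoped RealInnerProductSpace

/-- Theorem 5.11, claim (5.41): when the termination criterion
`‖X^{k+1} − X^k‖ ≤ δ/(aD)` of the proximal point method is met, the current
iterate is a `δ`-approximate solution of the variational inequality. -/
theorem prox_point_termination_approx
    {E : Type*} [NormedAddCommGroup E] [InnerProductSpace ℝ E]
    (Λ : Set E) (F : E → E) (a : ℝ) (ha : 0 < a)
    (X : ℕ → E) (hX : IsProxPointSeq Λ F a X)
    (D : ℝ) (hD : 0 < D) (hdiam : ∀ Y ∈ Λ, ∀ Z ∈ Λ, ‖Y - Z‖ ≤ D)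
    (δ : ℝ) (hδ : 0 < δ) (k : ℕ)
    (hterm : ‖X (k + 1) - X k‖ ≤ δ / (a * D)) :
    ∀ Y ∈ Λ, -δ ≤ ⟪F (X (k + 1)), Y - X (k + 1)⟫ := by
  intro Y hY
  have h := hX.2 k Y hY
  rw [inner_add_left, real_inner_smul_left] at h
  have h1 := real_inner_le_norm (X (k + 1) - X k) (Y - X (k + 1))
  have h2 := hdiam Y hY _ (hX.1 (k + 1))
  have h3 : ‖X (k + 1) - X k‖ * ‖Y - X (k + 1)‖ ≤ ‖X (k + 1) - X k‖ * D :=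
    mul_le_mul_of_nonneg_left h2 (norm_nonneg _)
  have h4 : ‖X (k + 1) - X k‖ * (a * D) ≤ δ := (le_div_iff₀ (mul_pos ha hD)).1 hterm
  have h5 := mul_le_mul_of_nonneg_left (h1.trans h3) ha.le
  linarith
end

section
/- Let E be a real Hilbert space, Λ ⊆ E nonempty, compact and convex, and F : Λ → E continuous and semistrictly quasi monotone on Λ. Then the dual (Minty) variational inequality has a solution: there exists X^d ∈ Λ such that ⟨F(X), X − X^d⟩ ≥ 0 for all X ∈ Λ. -/
open scoped RealInnerProductSpace

/-- Berge / Klee intersection theorem for compact convex sets. -/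
theorem berge_aux {E : Type*} [NormedAddCommGroup E] [InnerProductSpace ℝ E]
    {ι : Type*} [DecidableEq ι] (s : Finset ι) (hs : s.Nonempty) :
    ∀ (K : Set E) (G : ι → Set E), Convex ℝ K → K.Nonempty →
      (∀ i ∈ s, IsCompact (G i)) → (∀ i ∈ s, Convex ℝ (G i)) → (∀ i ∈ s, G i ⊆ K) →
      (∀ y ∈ K, ∃ i ∈ s, y ∈ G i) →
      (∀ j ∈ s, ∃ y, ∀ i ∈ s, i ≠ j → y ∈ G i) →
      ∃ y, ∀ i ∈ s, y ∈ G i := by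
  induction hs using Finset.Nonempty.cons_induction with
  | singleton a =>
    intro K G _ ⟨k, hk⟩ _ _ _ hcov _
    obtain ⟨i, hi, hki⟩ := hcov k hk
    refine ⟨k, fun j hj => ?_⟩
    rw [Finset.mem_singleton] at hi hj
    rw [hj, ← hi]; exact hki
  | cons a s ha hs ih =>
    intro K G hK _ hcomp hconv hsub hcov hint
    by_contra hno
    push Not at hno
    have hmem : ∀ i ∈ s, i ∈ Finset.cons a s ha := fun i hi => Finset.mem_cons.2 (Or.inr hi)
    have ha' : a ∈ Finset.cons a s ha := Finset.mem_cons_self a s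
    obtain ⟨b, hb⟩ := hs
    let A : Set E := ⋂ i ∈ s, G i
    have hAconv : Convex ℝ A := convex_iInter₂ fun i hi => hconv i (hmem i hi)
    have hAclosed : IsClosed A := isClosed_biInter fun i hi => (hcomp i (hmem i hi)).isClosed
    have hAcomp : IsCompact A :=
      (hcomp b (hmem b hb)).of_isClosed_subset hAclosed (Set.biInter_subset_of_mem hb)
    have hdisj : Disjoint A (G a) := by
      rw [Set.disjoint_left]
      intro x hxA hxa
      obtain ⟨i, hi, hxi⟩ := hno x
      rcases Finset.mem_cons.1 hi with rfl | hi
      · exact hxi hxa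
      · exact hxi (Set.mem_iInter₂.1 hxA i hi)
    obtain ⟨f, u, v, hfu, huv, hfv⟩ := geometric_hahn_banach_compact_closed hAconv hAcomp
      (hconv a ha') (hcomp a ha').isClosed hdisj
    obtain ⟨p, hp⟩ := hint a ha'
    have hps : ∀ i ∈ s, p ∈ G i := fun i hi => hp i (hmem i hi) (by rintro rfl; exact ha hi)
    have hfp : f p < u := hfu p (Set.mem_iInter₂.2 hps)
    -- a point of the hyperplane on a segment
    have hseg : ∀ q ∈ G a, ∀ C : Set E, Convex ℝ C → p ∈ C → q ∈ C → True →
        ∃ α β : ℝ, 0 ≤ α ∧ 0 ≤ β ∧ α + β = 1 ∧ f (α • p + β • q) = u := by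
      intro q hq _ _ _ _ _
      have hfq : u < f q := huv.trans (hfv q hq)
      have hd : 0 < f q - f p := by linarith
      refine ⟨(f q - u) / (f q - f p), (u - f p) / (f q - f p),
        div_nonneg (by linarith) hd.le, div_nonneg (by linarith) hd.le, ?_, ?_⟩
      · field_simp; ring
      · simp only [map_add, map_smul, smul_eq_mul]
        field_simp; ring
    have hHc : Convex ℝ {x : E | f x = u} := by
      intro x hx y hy α β _ _ hαβ
      simp only [Set.mem_setOf_eq] at *
      simp only [map_add, map_smul, smul_eq_mul, hx, hy]
      rw [← add_mul, hαβ, one_mul]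
    have hHcl : IsClosed {x : E | f x = u} := isClosed_eq f.continuous continuous_const
    have key := ih (K ∩ {x | f x = u}) (fun i => G i ∩ {x | f x = u}) (hK.inter hHc) ?_
      (fun i hi => (hcomp i (hmem i hi)).inter_right hHcl)
      (fun i hi => (hconv i (hmem i hi)).inter hHc)
      (fun i hi => Set.inter_subset_inter_left _ (hsub i (hmem i hi))) ?_ ?_
    · obtain ⟨y, hy⟩ := key
      have h1 := hfu y (Set.mem_iInter₂.2 fun i hi => (hy i hi).1)
      have h2 : f y = u := (hy b hb).2
      linarith
    · obtain ⟨q, hq⟩ := hint b (hmem b hb)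
      have hqa : q ∈ G a := hq a ha' (by rintro rfl; exact ha hb)
      have hpK : p ∈ K := hsub b (hmem b hb) (hps b hb)
      have hqK : q ∈ K := hsub a ha' hqa
      obtain ⟨α, β, h0, h1, h2, h3⟩ := hseg q hqa K hK hpK hqK trivial
      exact ⟨_, hK hpK hqK h0 h1 h2, h3⟩
    · rintro y ⟨hyK, hyu⟩
      obtain ⟨i, hi, hyi⟩ := hcov y hyK
      rcases Finset.mem_cons.1 hi with rfl | hi
      · have h1 := hfv y hyi
        have h2 : f y = u := hyu
        linarith
      · exact ⟨i, hi, hyi, hyu⟩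
    · intro j hj
      obtain ⟨q, hq⟩ := hint j (hmem j hj)
      have hqa : q ∈ G a := hq a ha' (by rintro rfl; exact ha hj)
      obtain ⟨α, β, h0, h1, h2, h3⟩ := hseg q hqa Set.univ convex_univ trivial trivial trivial
      exact ⟨_, fun i hi hij => ⟨hconv i (hmem i hi) (hps i hi) (hq i (hmem i hi) hij) h0 h1 h2,
        h3⟩⟩

/-- Semistrict quasi monotonicity implies proper quasi monotonicity. -/
theorem proper_aux {E : Type*} [NormedAddCommGroup E] [InnerProductSpace ℝ E]
    (Λ : Set E) (hconv : Convex ℝ Λ) (F : E → E)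
    (hquasi : ∀ X₁ ∈ Λ, ∀ X₂ ∈ Λ,
      0 < ⟪F X₂, X₁ - X₂⟫ → 0 ≤ ⟪F X₁, X₁ - X₂⟫)
    (hsemistrict : ∀ X₁ ∈ Λ, ∀ X₂ ∈ Λ, 0 < ⟪F X₂, X₁ - X₂⟫ →
      ∃ lam : ℝ, lam ∈ Set.Ioo (0 : ℝ) (1 / 2) ∧
        0 < ⟪F (X₁ + lam • (X₂ - X₁)), X₁ - X₂⟫)
    (s : Finset E) (hs : s.Nonempty) (hsΛ : (s : Set E) ⊆ Λ)
    (y : E) (hy : y ∈ convexHull ℝ (s : Set E)) :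
    ∃ x ∈ s, 0 ≤ ⟪F x, x - y⟫ := by
  by_contra hno
  push Not at hno
  have hpos : ∀ x ∈ s, 0 < ⟪F x, y - x⟫ := by
    intro x hx
    have := hno x hx
    rw [← neg_sub, inner_neg_right] at this
    linarith
  have hyΛ : y ∈ Λ := convexHull_min hsΛ hconv hy
  obtain ⟨b, hb⟩ := hs
  have hseg : ∀ t : ℝ, 0 ≤ t → t ≤ 1 → y + t • (b - y) ∈ Λ := fun t h0 h1 =>
    hconv.add_smul_sub_mem hyΛ (hsΛ hb) ⟨h0, h1⟩
  have hsmall : ∀ n : ℕ, ∃ t : ℝ, 0 < t ∧ t ≤ (1 / 2) ^ n ∧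
      0 < ⟪F (y + t • (b - y)), y - b⟫ := by
    intro n
    induction n with
    | zero => exact ⟨1, one_pos, by simp, by simpa using hpos b hb⟩
    | succ n ih =>
      obtain ⟨t, ht0, htn, ht⟩ := ih
      have ht1 : t ≤ 1 := htn.trans (pow_le_one₀ (by norm_num) (by norm_num))
      have e : y - (y + t • (b - y)) = t • (y - b) := by module
      obtain ⟨l, ⟨hl0, hl1⟩, hl⟩ := hsemistrict y hyΛ _ (hseg t ht0.le ht1) (by
        rw [e, inner_smul_right]; exact mul_pos ht0 ht)
      rw [e, inner_smul_right] at hl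
      refine ⟨l * t, mul_pos hl0 ht0, ?_, ?_⟩
      · rw [pow_succ]; nlinarith
      · have e2 : y + l • (y + t • (b - y) - y) = y + (l * t) • (b - y) := by module
        rw [e2] at hl
        exact pos_of_mul_pos_right hl ht0.le
  have hev : ∀ᶠ t : ℝ in nhds 0, ∀ x ∈ s, 0 < ⟪F x, y + t • (b - y) - x⟫ := by
    rw [Filter.eventually_all_finset]
    intro x hx
    have hc : Continuous fun t : ℝ => ⟪F x, y + t • (b - y) - x⟫ := by fun_prop
    exact hc.continuousAt.eventually (lt_mem_nhds (by simpa using hpos x hx))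
  obtain ⟨ε, hε, hball⟩ := Metric.eventually_nhds_iff.1 hev
  obtain ⟨n, hn⟩ := exists_pow_lt_of_lt_one hε (by norm_num : (1 / 2 : ℝ) < 1)
  obtain ⟨t, ht0, htn, ht⟩ := hsmall n
  have ht1 : t ≤ 1 := htn.trans (pow_le_one₀ (by norm_num) (by norm_num))
  have hz := hball (y := t) (by rw [Real.dist_eq, sub_zero, abs_of_pos ht0]; linarith)
  have hzΛ := hseg t ht0.le ht1
  set z := y + t • (b - y) with hzdef
  have hle : ∀ x ∈ s, ⟪F z, x⟫ ≤ ⟪F z, z⟫ := by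
    intro x hx
    have := hquasi z hzΛ x (hsΛ hx) (hz x hx)
    rw [inner_sub_right] at this
    linarith
  have hhalf : Convex ℝ {v : E | ⟪F z, v⟫ ≤ ⟪F z, z⟫} :=
    convex_halfSpace_le (innerₛₗ ℝ (F z)).isLinear _
  have hyz : ⟪F z, y⟫ ≤ ⟪F z, z⟫ := convexHull_min (fun x hx => hle x hx) hhalf hy
  have e : z = y - t • (y - b) := by rw [hzdef]; module
  have : ⟪F z, z⟫ = ⟪F z, y⟫ - t * ⟪F z, y - b⟫ := by
    conv_lhs => rw [show ⟪F z, z⟫ = ⟪F z, y - t • (y - b)⟫ from congrArg _ e]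
    rw [inner_sub_right, inner_smul_right]
  have := mul_pos ht0 ht
  linarith

/-- Finite version. -/
theorem finite_aux {E : Type*} [NormedAddCommGroup E] [InnerProductSpace ℝ E]
    (F : E → E) (s : Finset E)
    (hprop : ∀ r : Finset E, r ⊆ s → r.Nonempty → ∀ y ∈ convexHull ℝ (r : Set E),
      ∃ x ∈ r, 0 ≤ ⟪F x, x - y⟫) (hs : s.Nonempty) :
    ∃ y ∈ convexHull ℝ (s : Set E), ∀ x ∈ s, 0 ≤ ⟪F x, x - y⟫ := by
  classical
  induction s using Finset.strongInduction with
  | H s ih =>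
    have hclosed : ∀ x : E, IsClosed {y : E | 0 ≤ ⟪F x, x - y⟫} := fun x =>
      isClosed_le continuous_const (by fun_prop)
    have hcvx : ∀ x : E, Convex ℝ {y : E | 0 ≤ ⟪F x, x - y⟫} := by
      intro x
      have : {y : E | 0 ≤ ⟪F x, x - y⟫} = {y : E | ⟪F x, y⟫ ≤ ⟪F x, x⟫} := by
        ext y; simp [inner_sub_right]
      rw [this]
      exact convex_halfSpace_le (innerₛₗ ℝ (F x)).isLinear _
    obtain ⟨y, hy⟩ := berge_aux s hs (convexHull ℝ (s : Set E))
      (fun x => convexHull ℝ (s : Set E) ∩ {y : E | 0 ≤ ⟪F x, x - y⟫})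
      (convex_convexHull ℝ _) (by simpa using hs)
      (fun x _ => (s.finite_toSet.isCompact_convexHull ℝ).inter_right (hclosed x))
      (fun x _ => (convex_convexHull ℝ _).inter (hcvx x))
      (fun x _ => Set.inter_subset_left)
      (fun y hy => by
        obtain ⟨x, hx, h⟩ := hprop s subset_rfl hs y hy
        exact ⟨x, hx, hy, h⟩)
      (fun j hj => by
        by_cases he : (s.erase j).Nonempty
        · obtain ⟨y, hy, h⟩ := ih (s.erase j) (Finset.erase_ssubset hj)
            (fun r hr => hprop r (hr.trans (Finset.erase_subset _ _))) he
          exact ⟨y, fun i hi hij => ⟨convexHull_mono (by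
            exact_mod_cast Finset.erase_subset j s) hy, h i (Finset.mem_erase.2 ⟨hij, hi⟩)⟩⟩
        · exact ⟨j, fun i hi hij => (he ⟨i, Finset.mem_erase.2 ⟨hij, hi⟩⟩).elim⟩)
    obtain ⟨b, hb⟩ := hs
    exact ⟨y, (hy b hb).1, fun x hx => (hy x hx).2⟩

/-- Theorem 5.15: if `F` is continuous and semistrictly quasi monotone on a
nonempty compact convex subset `Λ` of a real Hilbert space, then the dual
(Minty) variational inequality has a solution. -/
theorem dual_solvability_of_semistrictly_quasimonotone
    {E : Type*} [NormedAddCommGroup E] [InnerProductSpace ℝ E] [CompleteSpace E]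
    (Λ : Set E) (hne : Λ.Nonempty) (hcomp : IsCompact Λ) (hconv : Convex ℝ Λ)
    (F : E → E) (hF : ContinuousOn F Λ)
    (hquasi : ∀ X₁ ∈ Λ, ∀ X₂ ∈ Λ,
      0 < ⟪F X₂, X₁ - X₂⟫ → 0 ≤ ⟪F X₁, X₁ - X₂⟫)
    (hsemistrict : ∀ X₁ ∈ Λ, ∀ X₂ ∈ Λ, 0 < ⟪F X₂, X₁ - X₂⟫ →
      ∃ lam : ℝ, lam ∈ Set.Ioo (0 : ℝ) (1 / 2) ∧
        0 < ⟪F (X₁ + lam • (X₂ - X₁)), X₁ - X₂⟫) :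
    ∃ Xd ∈ Λ, ∀ X ∈ Λ, 0 ≤ ⟪F X, X - Xd⟫ := by
  classical
  have key := hcomp.inter_iInter_nonempty
    (fun x : Λ => {y : E | 0 ≤ ⟪F x, (x : E) - y⟫})
    (fun x => isClosed_le continuous_const (by fun_prop)) (by
      intro u
      by_cases hu : u.Nonempty
      · have hsub : ((u.image Subtype.val : Finset E) : Set E) ⊆ Λ := by
          intro x hx
          simp only [Finset.coe_image, Set.mem_image] at hx
          obtain ⟨x', _, rfl⟩ := hx
          exact x'.2
        obtain ⟨y, hy, h⟩ := finite_aux F (u.image Subtype.val)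
          (fun r hr hrn y hy => proper_aux Λ hconv F hquasi hsemistrict r hrn
            (fun x hx => hsub (hr hx)) y hy) (hu.image _)
        exact ⟨y, convexHull_min hsub hconv hy, Set.mem_iInter₂.2 fun x hx =>
          h x (Finset.mem_image_of_mem _ hx)⟩
      · obtain ⟨k, hk⟩ := hne
        exact ⟨k, hk, Set.mem_iInter₂.2 fun x hx => (hu ⟨x, hx⟩).elim⟩)
  obtain ⟨y, hy, h⟩ := key
  exact ⟨y, hy, fun X hX => Set.mem_iInter.1 h ⟨X, hX⟩⟩
end

section
/- Let H be a real Hilbert space, K ⊆ H a nonempty compact convex subset, and T : K → H a continuous map. Then there exists u₀ ∈ K such that ⟨T(u₀), u − u₀⟩ ≥ 0 for all u ∈ K. -/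
open scoped RealInnerProductSpace

/-- A finite set `R` is dominant for a family of orders if every element is below all
of `R` in one of the orders. -/
def ScarfDom {ι V L : Type*} [LinearOrder L] (o : ι → V → L) (R : Finset V) : Prop :=
  ∀ w, ∃ i, ∀ s ∈ R, o i w ≤ o i s

lemma ScarfDom.mono {ι V L : Type*} [LinearOrder L] {o : ι → V → L} {R D : Finset V}
    (h : ScarfDom o R) (hD : D ⊆ R) : ScarfDom o D := fun w => by
  obtain ⟨i, hi⟩ := h w
  exact ⟨i, fun s hs => hi s (hD hs)⟩

/-- A door has exactly two rooms. -/
lemma scarf_door {ι V L : Type*} [Fintype ι] [DecidableEq ι] [Fintype V] [DecidableEq V]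
    [LinearOrder L] (o : ι → V → L) (ho : ∀ i, Function.Injective (o i)) (e : ι → V)
    (he : Function.Injective e)
    (hbig : ∀ i j v, i ≠ j → v ∉ Set.range e → o i v < o i (e j))
    (D : Finset V) (hne : D.Nonempty) (hcard : D.card + 1 = Fintype.card ι)
    (hdom : ScarfDom o D) (hD : ∀ k, D ≠ (Finset.univ.erase k).image e)
    (hmin : ∀ i v, o i (e i) ≤ o i v) :
    ∃ p q, p ≠ q ∧ ∀ v, (v ∉ D ∧ ScarfDom o (insert v D)) ↔ v = p ∨ v = q := by
  choose m hmD hm using fun i => D.exists_min_image (o i) hne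
  have hsurj : ∀ s ∈ D, ∃ i, m i = s := fun s hs => by
    obtain ⟨i, hi⟩ := hdom s
    exact ⟨i, ho i (le_antisymm (hm i s hs) (hi _ (hmD i)))⟩
  obtain ⟨a, -, b, -, hab, hmab⟩ : ∃ a ∈ (Finset.univ : Finset ι), ∃ b ∈ Finset.univ,
      a ≠ b ∧ m a = m b :=
    Finset.exists_ne_map_eq_of_card_lt_of_maps_to (t := D)
      (by rw [Finset.card_univ]; omega) (fun i _ => hmD i)
  have key : ∀ a b, a ≠ b → m a = m b → ∀ i j, i ≠ a → j ≠ a → m i = m j → i = j := by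
    intro a b hab hmab i j hi hj hij
    have himg : (Finset.univ.erase a).image m = D := by
      ext s
      simp only [Finset.mem_image, Finset.mem_erase, Finset.mem_univ, and_true]
      constructor
      · rintro ⟨i, -, rfl⟩; exact hmD i
      · intro hs
        obtain ⟨i, rfl⟩ := hsurj s hs
        by_cases h : i = a
        · exact ⟨b, hab.symm, by rw [h, hmab]⟩
        · exact ⟨i, h, rfl⟩
    have hinj : Set.InjOn m (Finset.univ.erase a : Finset ι) := by
      apply Finset.card_image_iff.1
      rw [himg, Finset.card_erase_of_mem (Finset.mem_univ _), Finset.card_univ]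
      omega
    exact hinj (by simpa using hi) (by simpa using hj) hij
  have exM : ∀ a : ι, ∃ v, (∀ k, k ≠ a → o k (m k) < o k v) ∧
      ∀ w, (∀ k, k ≠ a → o k (m k) < o k w) → o a w ≤ o a v := by
    intro a
    have hea : ∀ k, k ≠ a → o k (m k) < o k (e a) := by
      intro k hk
      by_contra hcon
      push Not at hcon
      apply hD k
      apply Finset.eq_of_subset_of_card_le
      · intro d hd
        have h1 := hcon.trans (hm k d hd)
        have h2 : d ∈ Set.range e := by
          by_contra h
          exact absurd (hbig k a d hk h) (not_lt.2 h1)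
        obtain ⟨j, rfl⟩ := h2
        simp only [Finset.mem_image, Finset.mem_erase, Finset.mem_univ, and_true]
        refine ⟨j, ?_, rfl⟩
        rintro rfl
        exact hk (he (ho _ (le_antisymm (hmin _ _) h1)))
      · refine Finset.card_image_le.trans ?_
        rw [Finset.card_erase_of_mem (Finset.mem_univ _), Finset.card_univ]
        omega
    classical
    obtain ⟨v, hv, hv'⟩ := (Finset.univ.filter
      (fun w => ∀ k, k ≠ a → o k (m k) < o k w)).exists_max_image (o a) ⟨e a, by simpa using hea⟩
    exact ⟨v, by simpa using hv, fun w hw => hv' w (by simpa using hw)⟩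
  have fwd : ∀ a b, a ≠ b → m a = m b → ∀ p, (∀ k, k ≠ a → o k (m k) < o k p) →
      (∀ w, (∀ k, k ≠ a → o k (m k) < o k w) → o a w ≤ o a p) →
      p ∉ D ∧ ScarfDom o (insert p D) := by
    intro a b hab hmab p hp hp'
    constructor
    · intro hpD
      obtain ⟨k, hk⟩ := hsurj p hpD
      by_cases h : k = a
      · have := hp b hab.symm
        rw [← hmab, ← h, hk] at this
        exact lt_irrefl _ this
      · have := hp k h
        rw [hk] at this
        exact lt_irrefl _ this
    · intro w
      by_cases hw : ∀ k, k ≠ a → o k (m k) < o k w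
      · refine ⟨a, fun s hs => ?_⟩
        rcases Finset.mem_insert.1 hs with rfl | hs
        · exact hp' w hw
        · obtain ⟨i, hi⟩ := hdom w
          by_cases h : i = a
          · subst h; exact hi s hs
          · exact absurd (hw i h) (not_lt.2 (hi _ (hmD i)))
      · push Not at hw
        obtain ⟨k, hk, hkw⟩ := hw
        refine ⟨k, fun s hs => ?_⟩
        rcases Finset.mem_insert.1 hs with rfl | hs
        · exact hkw.trans (hp k hk).le
        · exact hkw.trans (hm k s hs)
  have bwd : ∀ a b, a ≠ b → m a = m b → ∀ p, (∀ k, k ≠ a → o k (m k) < o k p) →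
      (∀ w, (∀ k, k ≠ a → o k (m k) < o k w) → o a w ≤ o a p) →
      ∀ v, v ∉ D → ScarfDom o (insert v D) → o a v < o a (m a) → v = p := by
    intro a b hab hmab p hp hp' v hvD hv hva
    have hvM : ∀ k, k ≠ a → o k (m k) < o k v := by
      intro k hk
      obtain ⟨j, hj⟩ := hv (m k)
      have hjk : m j = m k := ho j (le_antisymm (hm j _ (hmD k))
        (hj _ (Finset.mem_insert_of_mem (hmD j))))
      have hjv := hj v (Finset.mem_insert_self _ _)
      rw [← hjk] at hjv
      have hja : j ≠ a := by
        rintro rfl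
        exact absurd hva (not_lt.2 hjv)
      have := key a b hab hmab j k hja hk hjk
      subst this
      refine lt_of_le_of_ne hjv fun h => hvD ?_
      rw [← ho _ h]
      exact hmD _
    apply ho a
    refine le_antisymm (hp' v hvM) ?_
    obtain ⟨i, hi⟩ := hv p
    by_cases h : i = a
    · subst h; exact hi v (Finset.mem_insert_self _ _)
    · exact absurd (hp i h) (not_lt.2 (hi _ (Finset.mem_insert_of_mem (hmD i))))
  obtain ⟨p, hp, hp'⟩ := exM a
  obtain ⟨q, hq, hq'⟩ := exM b
  refine ⟨p, q, ?_, fun v => ⟨?_, ?_⟩⟩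
  · rintro rfl
    obtain ⟨i, hi⟩ := hdom p
    have h1 := hi _ (hmD i)
    by_cases h : i = a
    · subst h
      exact absurd (hq i hab) (not_lt.2 h1)
    · exact absurd (hp i h) (not_lt.2 h1)
  · rintro ⟨hvD, hv⟩
    obtain ⟨i, hi⟩ := hv v
    have hlt : o i v < o i (m i) := by
      refine lt_of_le_of_ne (hi _ (Finset.mem_insert_of_mem (hmD i))) fun h => hvD ?_
      rw [ho _ h]
      exact hmD _
    by_cases hia : i = a
    · subst hia
      exact Or.inl (bwd i b hab hmab p hp hp' v hvD hv hlt)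
    by_cases hib : i = b
    · subst hib
      exact Or.inr (bwd i a hab.symm hmab.symm q hq hq' v hvD hv hlt)
    exfalso
    obtain ⟨j, hj⟩ := hv (m i)
    have hji : m j = m i := ho j (le_antisymm (hm j _ (hmD i))
      (hj _ (Finset.mem_insert_of_mem (hmD j))))
    have hjv := hj v (Finset.mem_insert_self _ _)
    rw [← hji] at hjv
    have hne' : j ≠ i := by
      rintro rfl
      exact absurd hlt (not_lt.2 hjv)
    by_cases hja : j = a
    · subst hja
      exact hib (key j b hab hmab i b hia hab.symm (hji.symm.trans hmab))
    · exact hne' (key a b hab hmab j i hja hia hji)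
  · rintro (rfl | rfl)
    · exact fwd a b hab hmab v hp hp'
    · exact fwd b a hab.symm hmab.symm v hq hq'

lemma scarf {ι V L : Type*} [Fintype ι] [DecidableEq ι] [Nonempty ι] [Fintype V] [DecidableEq V]
    [LinearOrder L] (o : ι → V → L) (ho : ∀ i, Function.Injective (o i)) (e : ι → V)
    (hbig : ∀ i j v, i ≠ j → v ∉ Set.range e → o i v < o i (e j))
    (hmin : ∀ i v, o i (e i) ≤ o i v) (c : V → ι) (hc : ∀ i, c (e i) = i) :
    ∃ R : Finset V, ScarfDom o R ∧ ∀ i, ∃ s ∈ R, c s = i := by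
  classical
  by_contra hcon
  push Not at hcon
  have he : Function.Injective e := fun i j h => by rw [← hc i, h, hc]
  obtain ⟨i0⟩ := ‹Nonempty ι›
  set n := Fintype.card ι with hn
  have hn0 : 0 < n := Fintype.card_pos_iff.2 ⟨i0⟩
  let P : Finset (Finset V × V) := Finset.univ.filter fun x =>
    x.1.card + 1 = n ∧ x.1.image c = Finset.univ.erase i0 ∧ x.2 ∉ x.1 ∧ ScarfDom o (insert x.2 x.1)
  have hP : ∀ x, x ∈ P ↔ x.1.card + 1 = n ∧ x.1.image c = Finset.univ.erase i0 ∧ x.2 ∉ x.1 ∧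
      ScarfDom o (insert x.2 x.1) := fun x => by simp [P]
  -- room side
  have heven : Even P.card := by
    rw [Finset.card_eq_sum_card_fiberwise (f := fun x : Finset V × V => insert x.2 x.1)
      (t := Finset.univ) (fun _ _ => Finset.mem_coe.2 (Finset.mem_univ _))]
    refine Finset.even_sum _ fun R _ => ?_
    rcases (P.filter fun x => insert x.2 x.1 = R).eq_empty_or_nonempty with h | ⟨⟨D, s⟩, h⟩
    · rw [h]; simp
    rw [Finset.mem_filter, hP] at h
    obtain ⟨⟨h1, h2, h3, h4⟩, h5⟩ := h
    dsimp only at h1 h2 h3 h4 h5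
    have hcs : c s ≠ i0 := by
      intro hs
      obtain ⟨i, hi⟩ := hcon _ h4
      by_cases hii : i = i0
      · exact hi s (Finset.mem_insert_self _ _) (hs.trans hii.symm)
      · have : i ∈ D.image c := by rw [h2]; simpa using hii
        obtain ⟨d, hd, hdi⟩ := Finset.mem_image.1 this
        exact hi d (Finset.mem_insert_of_mem hd) hdi
    have : c s ∈ D.image c := by rw [h2]; simpa using hcs
    obtain ⟨t, ht, hts⟩ := Finset.mem_image.1 this
    have hst : s ≠ t := by rintro rfl; exact h3 ht
    have hinj : ∀ E : Finset V, E.card + 1 = n → E.image c = Finset.univ.erase i0 →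
        Set.InjOn c E := by
      intro E hE1 hE2
      apply Finset.card_image_iff.1
      rw [hE2, Finset.card_erase_of_mem (Finset.mem_univ _), Finset.card_univ]
      omega
    have hEq : (P.filter fun x => insert x.2 x.1 = R) = {(D, s), (R.erase t, t)} := by
      ext ⟨E, r⟩
      rw [Finset.mem_filter, hP]
      simp only [Finset.mem_insert, Finset.mem_singleton, Prod.mk.injEq]
      constructor
      · rintro ⟨⟨k1, k2, k3, k4⟩, k5⟩
        have hE : E = R.erase r := by rw [← k5, Finset.erase_insert k3]
        have hD' : D = R.erase s := by rw [← h5, Finset.erase_insert h3]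
        by_cases hrs : r = s
        · left; subst hrs; exact ⟨hE.trans hD'.symm, rfl⟩
        by_cases hrt : r = t
        · right; subst hrt; exact ⟨hE, rfl⟩
        exfalso
        apply hst
        apply hinj E k1 k2 _ _ hts.symm
        · rw [hE, ← h5]; simp [Ne.symm hrs]
        · rw [hE, ← h5]; simp [Ne.symm hrt, ht]
      · rintro (⟨rfl, rfl⟩ | ⟨rfl, rfl⟩)
        · exact ⟨⟨h1, h2, h3, h4⟩, h5⟩
        · have htR : r ∈ R := by rw [← h5]; exact Finset.mem_insert_of_mem ht
          refine ⟨⟨?_, ?_, by simp, ?_⟩, Finset.insert_erase htR⟩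
          · rw [Finset.card_erase_add_one htR, ← h5, Finset.card_insert_of_notMem h3, h1]
          · rw [← h2, ← h5]
            ext i
            simp only [Finset.mem_image, Finset.mem_erase, Finset.mem_insert]
            constructor
            · rintro ⟨x, ⟨hx, rfl | hx'⟩, rfl⟩
              · exact ⟨r, ht, hts⟩
              · exact ⟨x, hx', rfl⟩
            · rintro ⟨x, hx, rfl⟩
              by_cases hxr : x = r
              · exact ⟨s, ⟨hst, Or.inl rfl⟩, by rw [hxr, hts]⟩
              · exact ⟨x, ⟨hxr, Or.inr hx⟩, rfl⟩
          · rw [Finset.insert_erase htR, ← h5]; exact h4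
    rw [hEq, Finset.card_pair (by simp [hst])]
    exact even_two
  -- door side
  set D0 : Finset V := (Finset.univ.erase i0).image e with hD0
  have hD0card : D0.card + 1 = n := by
    rw [hD0, Finset.card_image_of_injective _ he, Finset.card_erase_add_one (Finset.mem_univ _),
      Finset.card_univ]
  have himge : ∀ k, ((Finset.univ.erase k).image e).image c = Finset.univ.erase k := by
    intro k
    rw [Finset.image_image]
    have : c ∘ e = id := funext hc
    rw [this, Finset.image_id]
  have hmemD0 : ∀ j, j ≠ i0 → e j ∈ D0 := fun j hj =>
    Finset.mem_image_of_mem _ (by simpa using hj)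
  have hei0 : e i0 ∉ D0 := by
    simp only [hD0, Finset.mem_image, Finset.mem_erase, Finset.mem_univ, and_true]
    rintro ⟨j, hj, hj'⟩
    exact hj (he hj')
  have hnot : ∀ w, w ∉ D0 → w = e i0 ∨ w ∉ Set.range e := by
    intro w hw
    by_cases h : w ∈ Set.range e
    · obtain ⟨j, rfl⟩ := h
      by_cases hj : j = i0
      · left; rw [hj]
      · exact absurd (hmemD0 j hj) hw
    · exact Or.inr h
  have hodd : Odd P.card := by
    rw [Finset.card_eq_sum_card_fiberwise (f := fun x : Finset V × V => x.1)
      (t := Finset.univ) (fun _ _ => Finset.mem_coe.2 (Finset.mem_univ _)),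
      ← Finset.add_sum_erase _ _ (Finset.mem_univ D0)]
    apply Odd.add_even
    · obtain ⟨p, hp, hp'⟩ := (D0ᶜ).exists_max_image (o i0) ⟨e i0, by simpa using hei0⟩
      rw [Finset.mem_compl] at hp
      have : (P.filter fun x => x.1 = D0) = {(D0, p)} := by
        ext ⟨E, v⟩
        rw [Finset.mem_filter, hP]
        simp only [Finset.mem_singleton, Prod.mk.injEq]
        constructor
        · rintro ⟨⟨k1, k2, k3, k4⟩, rfl⟩
          refine ⟨rfl, ho i0 (le_antisymm (hp' v (by simpa using k3)) ?_)⟩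
          rcases hnot p hp with rfl | hpe
          · exact hmin _ _
          obtain ⟨i, hi⟩ := k4 p
          by_cases h : i = i0
          · subst h; exact hi v (Finset.mem_insert_self _ _)
          · exfalso
            apply hpe
            exact ⟨i, ho i (le_antisymm (hmin _ _)
              (hi _ (Finset.mem_insert_of_mem (hmemD0 i h))))⟩
        · rintro ⟨rfl, rfl⟩
          refine ⟨⟨hD0card, himge i0, hp, ?_⟩, rfl⟩
          intro w
          by_cases hw : w ∈ D0
          · obtain ⟨j, -, rfl⟩ := Finset.mem_image.1 hw
            exact ⟨j, fun s _ => hmin _ _⟩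
          · refine ⟨i0, fun s hs => ?_⟩
            rcases Finset.mem_insert.1 hs with rfl | hs
            · exact hp' w (by simpa using hw)
            · rcases hnot w hw with rfl | hwe
              · exact hmin _ _
              · obtain ⟨j, hj, rfl⟩ := Finset.mem_image.1 hs
                exact (hbig i0 j w (Finset.ne_of_mem_erase hj).symm hwe).le
      rw [this, Finset.card_singleton]
      exact odd_one
    · refine Finset.even_sum _ fun D hD => ?_
      have hDne := Finset.ne_of_mem_erase hD
      rcases (P.filter fun x => x.1 = D).eq_empty_or_nonempty with h | ⟨⟨D', s⟩, h⟩
      · rw [h]; simp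
      rw [Finset.mem_filter, hP] at h
      obtain ⟨⟨h1, h2, h3, h4⟩, h5⟩ := h
      dsimp only at h1 h2 h3 h4 h5
      subst h5
      have hne : D'.Nonempty := by
        rw [Finset.nonempty_iff_ne_empty]
        rintro rfl
        apply hDne
        symm
        rw [← Finset.card_eq_zero]
        rw [Finset.card_empty] at h1
        omega
      obtain ⟨p, q, hpq, hpq'⟩ := scarf_door o ho e he hbig D' hne h1
        (h4.mono (Finset.subset_insert _ _)) (by
          intro k hk
          have h6 := himge k
          rw [← hk, h2] at h6
          have : k = i0 := by
            by_contra hki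
            have : k ∈ Finset.univ.erase i0 := by simpa using hki
            rw [h6] at this
            simp at this
          subst this
          exact hDne hk) hmin
      have : (P.filter fun x => x.1 = D') = {(D', p), (D', q)} := by
        ext ⟨E, v⟩
        rw [Finset.mem_filter, hP]
        simp only [Finset.mem_insert, Finset.mem_singleton, Prod.mk.injEq]
        constructor
        · rintro ⟨⟨k1, k2, k3, k4⟩, rfl⟩
          rcases (hpq' v).1 ⟨k3, k4⟩ with h | h
          · exact Or.inl ⟨rfl, h⟩
          · exact Or.inr ⟨rfl, h⟩
        · intro h
          have hE : E = D' := by rcases h with h | h <;> exact h.1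
          subst hE
          have := (hpq' v).2 (by rcases h with h | h; exacts [Or.inl h.2, Or.inr h.2])
          exact ⟨⟨h1, h2, this.1, this.2⟩, rfl⟩
      rw [this, Finset.card_pair (by simp [hpq])]
      exact even_two
  exact (Nat.not_even_iff_odd.2 hodd) heven

/-- Combinatorial conclusion for a finite set of points of the simplex. -/
lemma scarf_points {ι : Type*} [Fintype ι] [DecidableEq ι] [Nonempty ι]
    (W : Finset (ι → ℝ)) (hW : ∀ w ∈ W, w ∈ stdSimplex ℝ ι) (hne : W.Nonempty)
    (c : (ι → ℝ) → ι) :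
    ∃ (S : Finset (ι → ℝ)) (C : Finset ι), S ⊆ W ∧ C.Nonempty ∧
      (∀ i ∈ C, ∃ s ∈ S, c s = i) ∧ (∀ w ∈ W, ∃ i ∈ C, ∀ s ∈ S, w i ≤ s i) := by
  classical
  let V := W ⊕ ι
  let idx : V ≃ Fin (Fintype.card V) := Fintype.equivFin V
  let val : ι → V → ℝ := fun i => Sum.elim (fun w => w.1 i) (fun j => if j = i then -1 else 2)
  let o : ι → V → ℝ ×ₗ Fin (Fintype.card V) := fun i v => toLex (val i v, idx v)
  have hle : ∀ i v w, o i v ≤ o i w → val i v ≤ val i w := by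
    intro i v w h
    rcases (Prod.Lex.toLex_le_toLex).1 h with h | h
    · exact h.le
    · exact h.1.le
  have hlt : ∀ i v w, val i v < val i w → o i v < o i w := by
    intro i v w h
    exact (Prod.Lex.toLex_lt_toLex).2 (Or.inl h)
  have hpos : ∀ (w : W) i, 0 ≤ w.1 i := fun w i => (hW _ w.2).1 i
  have hle1 : ∀ (w : W) i, w.1 i ≤ 1 := fun w i => by
    rw [← (hW _ w.2).2]
    exact Finset.single_le_sum (fun j _ => hpos w j) (Finset.mem_univ i)
  obtain ⟨R, hR, hRc⟩ := scarf (ι := ι) (V := V) o (by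
      intro i v w h
      have := congrArg (fun x => (ofLex x).2) h
      exact idx.injective this) Sum.inr (by
      intro i j v hij hv
      rcases v with w | k
      · apply hlt
        have := hle1 w i
        simp only [val, Sum.elim_inl, Sum.elim_inr, if_neg hij.symm]
        linarith
      · exact absurd ⟨k, rfl⟩ hv) (by
      intro i v
      rcases v with w | k
      · apply (hlt _ _ _ _).le
        have := hpos w i
        simp only [val, Sum.elim_inl, Sum.elim_inr, if_true]
        linarith
      · by_cases h : k = i
        · rw [h]
        · apply (hlt _ _ _ _).le
          simp only [val, Sum.elim_inr, if_true, if_neg h]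
          norm_num) (Sum.elim (fun w => c w.1) id) (fun i => rfl)
  have hdomW : ∀ w ∈ W, ∃ i, Sum.inr i ∉ R ∧ ∀ (s : W), Sum.inl s ∈ R → w i ≤ s.1 i := by
    intro w hw
    obtain ⟨i, hi⟩ := hR (Sum.inl ⟨w, hw⟩)
    refine ⟨i, fun h => ?_, fun s hs => hle _ _ _ (hi _ hs)⟩
    have := hle _ _ _ (hi _ h)
    have h2 := hpos ⟨w, hw⟩ i
    simp only [val, Sum.elim_inl, Sum.elim_inr, if_true] at this h2
    linarith
  refine ⟨W.filter (fun w => ∃ h : w ∈ W, (Sum.inl ⟨w, h⟩ : V) ∈ R),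
    Finset.univ.filter (fun i => (Sum.inr i : V) ∉ R), Finset.filter_subset _ _, ?_, ?_, ?_⟩
  · obtain ⟨w, hw⟩ := hne
    obtain ⟨i, hi, -⟩ := hdomW w hw
    exact ⟨i, by simpa using hi⟩
  · intro i hi
    have hi' : (Sum.inr i : V) ∉ R := by simpa using hi
    obtain ⟨s, hs, hsi⟩ := hRc i
    rcases s with w | k
    · exact ⟨w.1, Finset.mem_filter.2 ⟨w.2, w.2, hs⟩, hsi⟩
    · have : k = i := hsi
      exact absurd (this ▸ hs) hi'
  · intro w hw
    obtain ⟨i, hi, h⟩ := hdomW w hw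
    refine ⟨i, by simpa using hi, fun s hs => ?_⟩
    obtain ⟨-, h1, h2⟩ := Finset.mem_filter.1 hs
    exact h ⟨s, h1⟩ h2

/-- Approximate version of the covering theorem. -/
lemma kkm_approx {ι : Type*} [Fintype ι] [DecidableEq ι] [Nonempty ι]
    (c : (ι → ℝ) → ι) (η : ℝ) (hη : 0 < η) :
    ∃ y ∈ stdSimplex ℝ ι, ∀ i, y i ≤ η ∨ ∃ s ∈ stdSimplex ℝ ι, c s = i ∧ dist y s ≤ η := by
  classical
  set n : ℝ := (Fintype.card ι : ℝ) with hn
  have hn0 : 0 < n := by rw [hn]; exact_mod_cast Fintype.card_pos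
  have hε : 0 < η / n := by positivity
  obtain ⟨t, htΔ, htf, htc⟩ := (isCompact_stdSimplex ℝ ι).finite_cover_balls hε
  obtain ⟨i1⟩ := ‹Nonempty ι›
  have hmem1 : Pi.single i1 1 ∈ stdSimplex ℝ ι := single_mem_stdSimplex ℝ i1
  have htne : htf.toFinset.Nonempty := by
    obtain ⟨x, hx, -⟩ := Set.mem_iUnion₂.1 (htc hmem1)
    exact ⟨x, by simpa using hx⟩
  haveI : Nonempty ι := ⟨i1⟩
  obtain ⟨S, C, hSW, hC, hcS, hdom⟩ := scarf_points htf.toFinset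
    (fun w hw => htΔ (by simpa using hw)) htne c
  have hSΔ : ∀ s ∈ S, s ∈ stdSimplex ℝ ι := fun s hs => htΔ (by simpa using hSW hs)
  have hSne : S.Nonempty := by
    obtain ⟨i, hi⟩ := hC
    obtain ⟨s, hs, -⟩ := hcS i hi
    exact ⟨s, hs⟩
  choose m hmS hm using fun i => S.exists_min_image (fun s => s i) hSne
  have hm0 : ∀ i, 0 ≤ m i i := fun i => (hSΔ _ (hmS i)).1 i
  -- the minima nearly sum to one
  have hsum : 1 - η ≤ ∑ i ∈ C, m i i := by
    by_contra hlt
    push Not at hlt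
    set δ : ℝ := (1 - ∑ i ∈ C, m i i) / C.card with hδ
    have hCpos : (0 : ℝ) < C.card := by exact_mod_cast hC.card_pos
    have hCn : (C.card : ℝ) ≤ n := by rw [hn]; exact_mod_cast C.card_le_univ
    have hδη : η / n < δ := by
      rw [hδ, div_lt_div_iff₀ hn0 hCpos]
      nlinarith
    have hδ0 : 0 < δ := hε.trans hδη
    let y : ι → ℝ := fun i => if i ∈ C then m i i + δ else 0
    have hy : y ∈ stdSimplex ℝ ι := by
      constructor
      · intro i
        simp only [y]
        split_ifs
        · have := hm0 i; linarith
        · exact le_rfl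
      · simp only [y]
        rw [Finset.sum_ite_mem, Finset.univ_inter, Finset.sum_add_distrib, Finset.sum_const,
          nsmul_eq_mul, hδ]
        field_simp
        ring
    obtain ⟨w, hw, hyw⟩ := Set.mem_iUnion₂.1 (htc hy)
    obtain ⟨i, hi, hiw⟩ := hdom w (by simpa using hw)
    have h1 := hiw _ (hmS i)
    have h2 : dist (y i) (w i) < η / n := lt_of_le_of_lt (dist_le_pi_dist y w i) hyw
    rw [Real.dist_eq, abs_lt] at h2
    have h3 : y i = m i i + δ := by simp [y, hi]
    linarith [h2.2]
  have hbound : ∀ s ∈ S, (∀ i ∈ C, s i ≤ m i i + η) ∧ ∀ i, i ∉ C → s i ≤ η := by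
    intro s hs
    have hs1 := (hSΔ s hs).2
    have hs0 := (hSΔ s hs).1
    have hsplit : ∑ i ∈ C, s i + ∑ i ∈ Cᶜ, s i = 1 := by rw [Finset.sum_add_sum_compl, hs1]
    have hge : ∀ i ∈ C, 0 ≤ s i - m i i := fun i _ => sub_nonneg.2 (hm i s hs)
    have hdiff : ∑ i ∈ C, (s i - m i i) + ∑ i ∈ Cᶜ, s i ≤ η := by
      rw [Finset.sum_sub_distrib]; linarith
    have hc0 : 0 ≤ ∑ i ∈ Cᶜ, s i := Finset.sum_nonneg fun i _ => hs0 i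
    have hd0 := Finset.sum_nonneg hge
    constructor
    · intro i hi
      have := Finset.single_le_sum hge hi
      linarith
    · intro i hi
      have := Finset.single_le_sum (f := s) (s := Cᶜ) (fun j _ => hs0 j) (by simpa using hi)
      linarith
  obtain ⟨y, hy⟩ := hSne
  refine ⟨y, hSΔ y hy, fun i => ?_⟩
  by_cases hi : i ∈ C
  · right
    obtain ⟨s, hs, hsi⟩ := hcS i hi
    refine ⟨s, hSΔ s hs, hsi, (dist_pi_le_iff hη.le).2 fun j => ?_⟩
    rw [Real.dist_eq, abs_le]
    by_cases hj : j ∈ C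
    · have h1 := (hbound s hs).1 j hj
      have h2 := (hbound y hy).1 j hj
      have h3 := hm j s hs
      have h4 := hm j y hy
      constructor <;> linarith
    · have h1 := (hbound s hs).2 j hj
      have h2 := (hbound y hy).2 j hj
      have h3 := (hSΔ s hs).1 j
      have h4 := (hSΔ y hy).1 j
      constructor <;> linarith
  · exact Or.inl ((hbound y hy).2 i hi)

/-- Covering theorem on the simplex. -/
lemma kkm_simplex {ι : Type*} [Fintype ι] [DecidableEq ι] [Nonempty ι]
    (A : ι → Set (ι → ℝ)) (hA : ∀ i, IsClosed (A i))
    (hcov : ∀ x ∈ stdSimplex ℝ ι, ∃ i, x ∈ A i) :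
    ∃ x ∈ stdSimplex ℝ ι, ∀ i, x i ≤ 0 ∨ x ∈ A i := by
  classical
  have hcov' : ∀ x, ∃ i, x ∈ stdSimplex ℝ ι → x ∈ A i := fun x => by
    by_cases hx : x ∈ stdSimplex ℝ ι
    · obtain ⟨i, hi⟩ := hcov x hx
      exact ⟨i, fun _ => hi⟩
    · exact ⟨Classical.arbitrary ι, fun h => absurd h hx⟩
  choose c hc using hcov'
  let g : (ι → ℝ) → ENNReal := fun y =>
    Finset.univ.sup fun i => min (ENNReal.ofReal (y i)) (Metric.infEDist y (A i))
  have hg : Continuous g := by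
    apply Continuous.finset_sup_apply
    intro i _
    exact (ENNReal.continuous_ofReal.comp (continuous_apply i)).min Metric.continuous_infEDist
  obtain ⟨x, hx, hmin⟩ := (isCompact_stdSimplex ℝ ι).exists_isMinOn
    ⟨_, single_mem_stdSimplex ℝ (Classical.arbitrary ι)⟩ hg.continuousOn
  have hsmall : ∀ η : ℝ, 0 < η → g x ≤ ENNReal.ofReal η := by
    intro η hη
    obtain ⟨y, hy, h⟩ := kkm_approx c η hη
    refine (hmin hy).trans (Finset.sup_le fun i _ => ?_)
    rcases h i with h | ⟨s, hs, hsi, hd⟩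
    · exact (min_le_left _ _).trans (ENNReal.ofReal_le_ofReal h)
    · refine (min_le_right _ _).trans ((Metric.infEDist_le_edist_of_mem (hsi ▸ hc s hs)).trans ?_)
      rw [edist_dist]
      exact ENNReal.ofReal_le_ofReal hd
  have hg0 : g x = 0 := by
    by_contra hne
    obtain ⟨r, hr0, hr⟩ := ENNReal.lt_iff_exists_nnreal_btwn.1 (pos_iff_ne_zero.2 hne)
    have := hsmall r (by exact_mod_cast hr0)
    rw [ENNReal.ofReal_coe_nnreal] at this
    exact absurd hr (not_lt.2 this)
  refine ⟨x, hx, fun i => ?_⟩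
  have hi : min (ENNReal.ofReal (x i)) (Metric.infEDist x (A i)) ≤ 0 := by
    rw [← hg0]
    exact Finset.le_sup (f := fun i => min (ENNReal.ofReal (x i)) (Metric.infEDist x (A i)))
      (Finset.mem_univ i)
  rcases min_le_iff.1 hi with h | h
  · left
    exact ENNReal.ofReal_eq_zero.1 (le_antisymm h bot_le)
  · right
    exact (Metric.mem_iff_infEDist_zero_of_closed (hA i)).2 (le_antisymm h bot_le)

/-- Finite version of the variational inequality. -/
lemma browder_finite {H : Type*} [NormedAddCommGroup H] [InnerProductSpace ℝ H]
    (K : Set H) (hKconv : Convex ℝ K) (T : H → H) (hT : ContinuousOn T K)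
    {ι : Type*} [Fintype ι] [Nonempty ι] (u : ι → H) (hu : ∀ i, u i ∈ K) :
    ∃ x ∈ K, ∀ i, 0 ≤ ⟪T x, u i - x⟫ := by
  classical
  let Φ : (ι → ℝ) → H := fun x => ∑ i, x i • u i
  have hΦ : Continuous Φ := by fun_prop
  have hΦK : Set.MapsTo Φ (stdSimplex ℝ ι) K := fun x hx =>
    hKconv.sum_mem (fun i _ => hx.1 i) hx.2 (fun i _ => hu i)
  have hTΦ : ContinuousOn (fun x => T (Φ x)) (stdSimplex ℝ ι) := hT.comp hΦ.continuousOn hΦK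
  have hTi : ∀ i, ContinuousOn (fun x => ⟪T (Φ x), u i⟫) (stdSimplex ℝ ι) := fun i =>
    hTΦ.inner continuousOn_const
  let A : ι → Set (ι → ℝ) := fun i =>
    ⋂ j, {x ∈ stdSimplex ℝ ι | ⟪T (Φ x), u i⟫ ≤ ⟪T (Φ x), u j⟫}
  obtain ⟨x, hx, h⟩ := kkm_simplex A
    (fun i => isClosed_iInter fun j => (isClosed_stdSimplex ℝ ι).isClosed_le (hTi i) (hTi j)) (by
      intro x hx
      obtain ⟨i, -, hi⟩ := Finset.univ.exists_min_image (fun i => ⟪T (Φ x), u i⟫)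
        Finset.univ_nonempty
      exact ⟨i, Set.mem_iInter.2 fun j => ⟨hx, hi j (Finset.mem_univ j)⟩⟩)
  refine ⟨Φ x, hΦK hx, fun j => ?_⟩
  rw [inner_sub_right, sub_nonneg]
  calc ⟪T (Φ x), Φ x⟫ = ∑ i, x i * ⟪T (Φ x), u i⟫ := by
        conv_lhs => rw [show Φ x = ∑ i, x i • u i from rfl]
        rw [inner_sum]
        simp only [inner_smul_right]
        rfl
    _ ≤ ∑ i, x i * ⟪T (Φ x), u j⟫ := by
        refine Finset.sum_le_sum fun i _ => ?_
        rcases h i with h | h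
        · rw [le_antisymm h (hx.1 i)]; simp
        · exact mul_le_mul_of_nonneg_left (Set.mem_iInter.1 h j).2 (hx.1 i)
    _ = ⟪T (Φ x), u j⟫ := by rw [← Finset.sum_mul, hx.2, one_mul]

/-- Theorem 4.1 (Browder, 1968), Hilbert-space instance: a continuous map on a
nonempty compact convex subset of a real Hilbert space admits a solution of the
associated variational inequality. -/
theorem browder_variational_inequality
    {H : Type*} [NormedAddCommGroup H] [InnerProductSpace ℝ H] [CompleteSpace H]
    (K : Set H) (hK : K.Nonempty) (hKc : IsCompact K) (hKconv : Convex ℝ K)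
    (T : H → H) (hT : ContinuousOn T K) :
    ∃ u₀ ∈ K, ∀ u ∈ K, 0 ≤ ⟪T u₀, u - u₀⟫ := by
  classical
  have hcl : ∀ u : K, IsClosed {x ∈ K | 0 ≤ ⟪T x, (u : H) - x⟫} := fun u =>
    hKc.isClosed.isClosed_le continuousOn_const
      (hT.inner (continuousOn_const.sub continuousOn_id))
  obtain ⟨x, hx, h⟩ := hKc.inter_iInter_nonempty
    (fun u : K => {x ∈ K | 0 ≤ ⟪T x, (u : H) - x⟫}) hcl (by
      intro s
      rcases s.eq_empty_or_nonempty with rfl | hs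
      · simpa using hK
      haveI : Nonempty s := hs.to_subtype
      obtain ⟨x, hx, h⟩ := browder_finite K hKconv T hT (ι := s) (fun i => (i.1 : H))
        (fun i => i.1.2)
      exact ⟨x, hx, Set.mem_iInter₂.2 fun u hu => ⟨hx, h ⟨u, hu⟩⟩⟩)
  exact ⟨x, hx, fun u hu => (Set.mem_iInter.1 h ⟨u, hu⟩).2⟩
end
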